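/- arXiv:1504.02429 — 2 statements merged into one kernel-verified Lean document; each statement's English description precedes it below -/
import Mathlib

section
/- Coupling of the annealed NBRW with uniform samples: let {X_k}_{0≤k≤t} be the NBRW started at a fixed x ∈ X under the annealed law (i.e. averaged over the uniformly random pairing π, generated sequentially along the walk). Then the law of (X_1, …, X_t) and the law of (X_1*, …, X_t*), where the X_k* are i.i.d. uniform on X, are within total-variation distance 2t²/N; in particular, for every θ > 0, |P(Π_{k=1}^t 1/deg(X_k) > θ) − P(Π_{k=1}^t 1/deg(X_k*) > θ)| ≤ 2t²/N. -/
open Classical Filter Finset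

noncomputable section

/-- The set of half-edges: `deg v` half-edges attached to each vertex `v`. -/
abbrev HE (k : ℕ) (dg : Fin k → ℕ) : Type := (v : Fin k) × Fin (dg v)

/-- A pairing is a fixed-point-free involution of the half-edges. -/
def IsPairing {k : ℕ} {dg : Fin k → ℕ} (π : Equiv.Perm (HE k dg)) : Prop :=
  (∀ x, π (π x) = x) ∧ ∀ x, π x ≠ x

/-- `N`, the total number of half-edges. -/
def Nh {k : ℕ} (dg : Fin k → ℕ) : ℕ := ∑ v, dg v

/-- The non-backtracking random walk transition matrix: from `x`, move to a uniformly
chosen neighbour of `π x` (a half-edge at the same vertex as `π x`, distinct from it). -/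
def nbrwP {k : ℕ} (dg : Fin k → ℕ) (π : Equiv.Perm (HE k dg)) :
    Matrix (HE k dg) (HE k dg) ℝ := fun x y =>
  if (π x).1 = y.1 ∧ π x ≠ y then ((dg (π x).1 : ℝ) - 1)⁻¹ else 0

/-- Total-variation distance to the uniform distribution at time `t`, from state `x`. -/
def Dx {k : ℕ} (dg : Fin k → ℕ) (π : Equiv.Perm (HE k dg)) (x : HE k dg) (t : ℕ) : ℝ :=
  (1 / 2) * ∑ y, |((nbrwP dg π) ^ t) x y - (Nh dg : ℝ)⁻¹|

/-- Worst-case total-variation distance to equilibrium at time `t`. -/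
def Dmax {k : ℕ} (dg : Fin k → ℕ) (π : Equiv.Perm (HE k dg)) (t : ℕ) : ℝ :=
  ⨆ x, Dx dg π x t

/-- Mixing time. -/
def tmixT {k : ℕ} (dg : Fin k → ℕ) (π : Equiv.Perm (HE k dg)) (ε : ℝ) : ℕ :=
  sInf {t : ℕ | Dmax dg π t < ε}

/-- The finite set of all pairings of the half-edges. -/
def PairingsF {k : ℕ} (dg : Fin k → ℕ) : Finset (Equiv.Perm (HE k dg)) :=
  univ.filter IsPairing

/-- Probability of an event under the uniformly random pairing. -/
def prP {k : ℕ} (dg : Fin k → ℕ) (Q : Equiv.Perm (HE k dg) → Prop) : ℝ :=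
  (((PairingsF dg).filter Q).card : ℝ) / ((PairingsF dg).card : ℝ)

/-- Mean logarithmic degree `μ` of a uniform half-edge. -/
def muD {k : ℕ} (dg : Fin k → ℕ) : ℝ :=
  (Nh dg : ℝ)⁻¹ * ∑ v, (dg v : ℝ) * Real.log ((dg v : ℝ) - 1)

/-- Variance `σ²` of the logarithmic degree of a uniform half-edge. -/
def sigsq {k : ℕ} (dg : Fin k → ℕ) : ℝ :=
  (Nh dg : ℝ)⁻¹ * ∑ v, (dg v : ℝ) * (Real.log ((dg v : ℝ) - 1) - muD dg) ^ 2

/-- Third absolute central moment `ϱ`. -/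
def rhoD {k : ℕ} (dg : Fin k → ℕ) : ℝ :=
  (Nh dg : ℝ)⁻¹ * ∑ v, (dg v : ℝ) * |Real.log ((dg v : ℝ) - 1) - muD dg| ^ 3

/-- Maximum degree `Δ`. -/
def DeltaD {k : ℕ} (dg : Fin k → ℕ) : ℕ := univ.sup dg

/-- The standard normal tail function `Φ`. -/
def Phi (lam : ℝ) : ℝ :=
  (Real.sqrt (2 * Real.pi))⁻¹ * ∫ u in Set.Ioi lam, Real.exp (-u ^ 2 / 2)

/-- Cutoff time `t⋆ = log N / μ`. -/
def tstar {k : ℕ} (dg : Fin k → ℕ) : ℝ := Real.log (Nh dg) / muD dg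

/-- Cutoff window `ω⋆ = √(σ² log N / μ³)`. -/
def wstar {k : ℕ} (dg : Fin k → ℕ) : ℝ :=
  Real.sqrt (sigsq dg * Real.log (Nh dg) / (muD dg) ^ 3)

/-- Quenched probability that the NBRW started at `x` follows the trajectory `z`. -/
def walkProb {k : ℕ} (dg : Fin k → ℕ) (π : Equiv.Perm (HE k dg)) (x : HE k dg)
    (t : ℕ) (z : Fin t → HE k dg) : ℝ :=
  ∏ i : Fin t,
    nbrwP dg π
      (if (i : ℕ) = 0 then x
       else z ⟨(i : ℕ) - 1, lt_of_le_of_lt (Nat.pred_le _) i.isLt⟩) (z i)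

/-- Annealed probability of the trajectory `z`: average over the uniform pairing. -/
def annealedProb {k : ℕ} (dg : Fin k → ℕ) (x : HE k dg) (t : ℕ)
    (z : Fin t → HE k dg) : ℝ :=
  ((PairingsF dg).card : ℝ)⁻¹ * ∑ π ∈ PairingsF dg, walkProb dg π x t z

/-- The weight of a trajectory: product of the inverse degrees of its half-edges. -/
def trajWeight {k : ℕ} (dg : Fin k → ℕ) {t : ℕ} (z : Fin t → HE k dg) : ℝ :=
  ∏ i : Fin t, ((dg (z i).1 : ℝ) - 1)⁻¹

/-- A finite type of even cardinality carries a fixed-point-free involution. -/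
lemma exists_fixedPointFree_involution {α : Type*} [Fintype α] (h : Even (Fintype.card α)) :
    ∃ π : Equiv.Perm α, (∀ x, π (π x) = x) ∧ ∀ x, π x ≠ x := by
  obtain ⟨m, hm⟩ := h
  have e : α ≃ Fin m × Bool := Fintype.equivOfCardEq (by simp [hm, mul_two])
  refine ⟨(e.trans ((Equiv.refl (Fin m)).prodCongr Equiv.boolNot)).trans e.symm, ?_, ?_⟩
  · intro x
    simp [Prod.map]
  · intro x hx
    have h2 := congrArg (fun a => (e a).2) hx
    simp at h2

/-- Prescribing one more pair of a pairing costs a factor at most the number of points. -/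
lemma card_prescribed_succ {α : Type*} [Fintype α] [DecidableEq α] {t : ℕ} (a b : Fin t → α)
    (ha : Function.Injective a) (hb : Function.Injective b) (hab : ∀ i j, a i ≠ b j)
    (n : Fin t) :
    #{π : Equiv.Perm α | ((∀ x, π (π x) = x) ∧ ∀ x, π x ≠ x) ∧
        ∀ i : Fin t, i < n → π (a i) = b i} ≤
      Fintype.card α * #{π : Equiv.Perm α | ((∀ x, π (π x) = x) ∧ ∀ x, π x ≠ x) ∧
        ∀ i : Fin t, i ≤ n → π (a i) = b i} := by
  rw [mul_comm]
  refine Finset.card_le_mul_card_image_of_maps_to (f := fun π : Equiv.Perm α => π (a n))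
    (t := univ) (fun _ _ => mem_univ _) _ ?_
  intro c _
  refine Finset.card_le_card_of_injOn
    (fun π => Equiv.swap (b n) c * π * Equiv.swap (b n) c) ?_ ?_
  · intro π hπ
    simp only [coe_filter, mem_filter, mem_univ, true_and, Set.mem_ofPred_eq] at hπ ⊢
    obtain ⟨⟨⟨hinv, hfix⟩, hpre⟩, hc⟩ := hπ
    have hcan : c ≠ a n := fun h => hfix (a n) (hc.trans h)
    refine ⟨⟨fun x => ?_, fun x hx => ?_⟩, fun i hi => ?_⟩
    · simp [hinv]
    · have h1 : Equiv.swap (b n) c (π (Equiv.swap (b n) c x)) = x := hx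
      have h2 := congrArg (Equiv.swap (b n) c) h1
      rw [Equiv.swap_apply_self] at h2
      exact hfix _ h2
    · simp only [Equiv.Perm.mul_apply]
      rcases hi.lt_or_eq with hlt | rfl
      · have h1 : a i ≠ c := by
          intro h
          apply hab n i
          rw [← hpre i hlt, h, ← hc, hinv]
        have h2 : b i ≠ c := by
          intro h
          rw [← hpre i hlt, ← hc] at h
          exact hlt.ne (ha (π.injective h))
        rw [Equiv.swap_apply_of_ne_of_ne (hab i n) h1, hpre i hlt,
          Equiv.swap_apply_of_ne_of_ne (fun h => hlt.ne (hb h)) h2]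
      · rw [Equiv.swap_apply_of_ne_of_ne (hab i i) hcan.symm, hc, Equiv.swap_apply_right]
  · intro π _ ρ _ h
    simpa using h

/-- A uniformly random pairing contains `t` prescribed disjoint pairs with probability at least
`(card α)⁻¹ ^ t`. -/
lemma card_pairings_le_pow_mul_card_prescribed {α : Type*} [Fintype α] [DecidableEq α] {t : ℕ}
    (a b : Fin t → α)
    (ha : Function.Injective a) (hb : Function.Injective b) (hab : ∀ i j, a i ≠ b j) :
    #{π : Equiv.Perm α | (∀ x, π (π x) = x) ∧ ∀ x, π x ≠ x} ≤
      Fintype.card α ^ t * #{π : Equiv.Perm α | ((∀ x, π (π x) = x) ∧ ∀ x, π x ≠ x) ∧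
        ∀ i : Fin t, π (a i) = b i} := by
  have key : ∀ n ≤ t, #{π : Equiv.Perm α | (∀ x, π (π x) = x) ∧ ∀ x, π x ≠ x} ≤
      Fintype.card α ^ n * #{π : Equiv.Perm α | ((∀ x, π (π x) = x) ∧ ∀ x, π x ≠ x) ∧
        ∀ i : Fin t, (i : ℕ) < n → π (a i) = b i} := by
    intro n
    induction n with
    | zero => intro _; simp
    | succ n ih =>
      intro hn
      refine (ih (by omega)).trans ?_
      rw [pow_succ, mul_assoc]
      refine Nat.mul_le_mul_left _ ?_
      have h := card_prescribed_succ a b ha hb hab ⟨n, hn⟩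
      simpa only [Fin.lt_def, Fin.le_def, Nat.lt_succ_iff] using h
  simpa using key t le_rfl

lemma sum_pi_prod_mul_one {ι β : Type*} [Fintype ι] [DecidableEq ι] [Fintype β] (m F : β → ℝ)
    (hm : ∑ b, m b = 1) (i : ι) :
    ∑ p : ι → β, (∏ l, m (p l)) * F (p i) = ∑ b, m b * F b := by
  have h1 : ∀ p : ι → β, (∏ l, m (p l)) * F (p i) =
      ∏ l, (m (p l) * if l = i then F (p l) else 1) := by
    intro p
    rw [prod_mul_distrib, prod_ite_eq' univ i]
    simp
  simp_rw [h1]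
  rw [← Fintype.prod_sum (fun l b => m b * if l = i then F b else 1),
    prod_eq_single i]
  · simp
  · intro l _ hl
    simp [hl, hm]
  · simp

lemma sum_pi_prod_mul_two {ι β : Type*} [Fintype ι] [DecidableEq ι] [Fintype β] (m F G : β → ℝ)
    (hm : ∑ b, m b = 1) {i j : ι} (hij : i ≠ j) :
    ∑ p : ι → β, (∏ l, m (p l)) * (F (p i) * G (p j)) =
      (∑ b, m b * F b) * ∑ b, m b * G b := by
  have h1 : ∀ p : ι → β, (∏ l, m (p l)) * (F (p i) * G (p j)) =
      ∏ l, (m (p l) * ((if l = i then F (p l) else 1) * if l = j then G (p l) else 1)) := by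
    intro p
    rw [prod_mul_distrib, prod_mul_distrib, prod_ite_eq' univ i, prod_ite_eq' univ j]
    simp
  simp_rw [h1]
  rw [← Fintype.prod_sum
    (fun l b => m b * ((if l = i then F b else 1) * if l = j then G b else 1))]
  have h2 : ∀ l, ∑ b, m b * ((if l = i then F b else 1) * if l = j then G b else 1) =
      (if l = i then ∑ b, m b * F b else 1) * if l = j then ∑ b, m b * G b else 1 := by
    intro l
    by_cases hi : l = i
    · have hj : l ≠ j := fun h => hij (hi.symm.trans h)
      simp [hi, hij]
    · by_cases hj : l = j
      · simp [hj, hij.symm]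
      · simp [hi, hj, hm]
  simp_rw [h2]
  rw [prod_mul_distrib, prod_ite_eq' univ i, prod_ite_eq' univ j]
  simp

/-- Two uniform functions of two independent samples agree with probability
`(card α)⁻¹`. -/
lemma collision_probability {ι α β : Type*} [Fintype ι] [DecidableEq ι] [Fintype α] [Nonempty α]
    [DecidableEq α] [Fintype β] (m : β → ℝ) (hm : ∑ b, m b = 1) (f g : β → α)
    (hf : ∀ a, ∑ b, m b * (if f b = a then 1 else 0) = (Fintype.card α : ℝ)⁻¹)
    (hg : ∀ a, ∑ b, m b * (if g b = a then 1 else 0) = (Fintype.card α : ℝ)⁻¹)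
    {i j : ι} (hij : i ≠ j) :
    ∑ p : ι → β, (∏ l, m (p l)) * (if f (p i) = g (p j) then 1 else 0) =
      (Fintype.card α : ℝ)⁻¹ := by
  have h1 : ∀ p : ι → β, (∏ l, m (p l)) * (if f (p i) = g (p j) then 1 else 0) =
      ∑ a, (∏ l, m (p l)) * ((if f (p i) = a then 1 else 0) * (if g (p j) = a then 1 else 0)) := by
    intro p
    rw [← mul_sum]
    simp [eq_comm]
  simp_rw [h1]
  rw [sum_comm]
  have h2 : ∀ a, ∑ p : ι → β, (∏ l, m (p l)) *
      ((if f (p i) = a then 1 else 0) * (if g (p j) = a then 1 else 0)) =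
      (Fintype.card α : ℝ)⁻¹ * (Fintype.card α : ℝ)⁻¹ := by
    intro a
    rw [sum_pi_prod_mul_two m (fun b => if f b = a then 1 else 0)
      (fun b => if g b = a then 1 else 0) hm hij, hf, hg]
  simp_rw [h2]
  have : (Fintype.card α : ℝ) ≠ 0 := by simp
  simp

/-- Probability of choosing `z` as a uniform neighbour of `y`. -/
def nbrKernel {k : ℕ} (dg : Fin k → ℕ) (y z : HE k dg) : ℝ :=
  if y.1 = z.1 ∧ y ≠ z then ((dg y.1 : ℝ) - 1)⁻¹ else 0

lemma nbrwP_eq_nbrKernel {k : ℕ} (dg : Fin k → ℕ) (π : Equiv.Perm (HE k dg)) (u v : HE k dg) :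
    nbrwP dg π u v = nbrKernel dg (π u) v := by
  simp only [nbrwP, nbrKernel]

lemma nbrKernel_self {k : ℕ} (dg : Fin k → ℕ) (y : HE k dg) : nbrKernel dg y y = 0 := by
  simp [nbrKernel]

lemma nbrKernel_nonneg {k : ℕ} (dg : Fin k → ℕ) (y z : HE k dg) : 0 ≤ nbrKernel dg y z := by
  unfold nbrKernel
  split_ifs
  · have h : 1 ≤ dg y.1 := Nat.one_le_iff_ne_zero.2 fun h => (h ▸ y.2 : Fin 0).elim0
    have h' : (1 : ℝ) ≤ dg y.1 := by exact_mod_cast h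
    exact inv_nonneg.2 (by linarith)
  · exact le_rfl

lemma nbrKernel_comm {k : ℕ} (dg : Fin k → ℕ) (y z : HE k dg) :
    nbrKernel dg y z = nbrKernel dg z y := by
  unfold nbrKernel
  by_cases h : y.1 = z.1
  · simp only [h, ne_comm (a := y)]
  · simp only [h, Ne.symm h, false_and, if_false]

lemma card_filter_vertex_eq {k : ℕ} (dg : Fin k → ℕ) (v : Fin k) :
    #{z : HE k dg | v = z.1} = dg v := by
  rw [card_filter, Fintype.sum_sigma, Finset.sum_eq_single v]
  · simp
  · intro w _ hw
    simp [hw.symm]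
  · simp

lemma sum_nbrKernel {k : ℕ} {dg : Fin k → ℕ} (hdg : ∀ v, 2 ≤ dg v) (y : HE k dg) :
    ∑ z, nbrKernel dg y z = 1 := by
  unfold nbrKernel
  rw [← sum_filter, sum_const, nsmul_eq_mul]
  have h : (univ.filter fun z : HE k dg => y.1 = z.1 ∧ y ≠ z) =
      (univ.filter fun z : HE k dg => y.1 = z.1).erase y := by
    ext z
    simp [and_comm, eq_comm]
  have h2 : (2 : ℝ) ≤ dg y.1 := by exact_mod_cast hdg y.1
  rw [h, card_erase_of_mem (by simp), card_filter_vertex_eq,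
    Nat.cast_sub (by have := hdg y.1; omega), Nat.cast_one]
  exact mul_inv_cancel₀ (by linarith)

lemma card_halfEdges {k : ℕ} (dg : Fin k → ℕ) : Fintype.card (HE k dg) = Nh dg := by
  simp [Nh]

/-- The state from which the `i`-th step of the trajectory `z` started at `x` is taken. -/
def prevState {α : Type*} {t : ℕ} (x : α) (z : Fin t → α) (i : Fin t) : α :=
  if (i : ℕ) = 0 then x else z ⟨(i : ℕ) - 1, lt_of_le_of_lt (Nat.pred_le _) i.isLt⟩

lemma walkProb_eq_prod {k : ℕ} (dg : Fin k → ℕ) (π : Equiv.Perm (HE k dg)) (x : HE k dg)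
    (t : ℕ) (z : Fin t → HE k dg) :
    walkProb dg π x t z = ∏ i, nbrKernel dg (π (prevState x z i)) (z i) :=
  prod_congr rfl fun _ _ => nbrwP_eq_nbrKernel _ _ _ _

lemma walkProb_cons {k : ℕ} (dg : Fin k → ℕ) (π : Equiv.Perm (HE k dg)) (x a : HE k dg)
    (t : ℕ) (z : Fin t → HE k dg) :
    walkProb dg π x (t + 1) (Fin.cons a z) = nbrKernel dg (π x) a * walkProb dg π a t z := by
  rw [walkProb_eq_prod, walkProb_eq_prod, Fin.prod_univ_succ]
  congr 1
  refine prod_congr rfl fun i _ => ?_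
  have h : prevState x (Fin.cons a z : Fin (t + 1) → HE k dg) i.succ = prevState a z i := by
    obtain ⟨i, hi⟩ := i
    cases i with
    | zero => rfl
    | succ i => rfl
  rw [h, Fin.cons_succ]

lemma sum_walkProb {k : ℕ} {dg : Fin k → ℕ} (hdg : ∀ v, 2 ≤ dg v) (π : Equiv.Perm (HE k dg))
    (t : ℕ) (x : HE k dg) : ∑ z, walkProb dg π x t z = 1 := by
  induction t generalizing x with
  | zero => simp [walkProb]
  | succ t ih =>
    rw [← (Fin.consEquiv fun _ => HE k dg).sum_comp, Fintype.sum_prod_type]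
    change ∑ a, ∑ z : Fin t → HE k dg, walkProb dg π x (t + 1) (Fin.cons a z) = 1
    simp only [walkProb_cons, ← mul_sum, ih, mul_one]
    exact sum_nbrKernel hdg _

lemma sum_annealedProb_le_one {k : ℕ} {dg : Fin k → ℕ} (hdg : ∀ v, 2 ≤ dg v)
    (t : ℕ) (x : HE k dg) : ∑ z, annealedProb dg x t z ≤ 1 := by
  unfold annealedProb
  rw [← mul_sum, sum_comm]
  simp only [sum_walkProb hdg, sum_const, nsmul_eq_mul, mul_one]
  exact inv_mul_le_one

lemma walkProb_eq_sum {k : ℕ} (dg : Fin k → ℕ) (π : Equiv.Perm (HE k dg)) (x : HE k dg)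
    (t : ℕ) (z : Fin t → HE k dg) :
    walkProb dg π x t z = ∑ y : Fin t → HE k dg,
      if ∀ i, π (prevState x z i) = y i then ∏ i, nbrKernel dg (y i) (z i) else 0 := by
  rw [walkProb_eq_prod, Finset.sum_eq_single fun i => π (prevState x z i)]
  · simp
  · intro y _ hy
    rw [if_neg fun h => hy (funext fun i => (h i).symm)]
  · simp

/-- The trajectory `z`, with matched half-edges `y`, never meets an already revealed
half-edge. -/
def FreshMatching {α : Type*} {t : ℕ} (x : α) (z y : Fin t → α) : Prop :=
  Function.Injective (prevState x z) ∧ Function.Injective y ∧ ∀ i j, prevState x z i ≠ y j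

lemma pairingsF_card_pos {k : ℕ} {dg : Fin k → ℕ} (heven : Even (Nh dg)) :
    0 < (PairingsF dg).card := by
  rw [← card_halfEdges] at heven
  obtain ⟨π, hπ⟩ := exists_fixedPointFree_involution heven
  exact card_pos.2 ⟨π, by simpa [PairingsF, IsPairing] using hπ⟩

/-- Lower bound on the annealed probability from trajectories meeting only fresh half-edges. -/
lemma le_annealedProb {k : ℕ} {dg : Fin k → ℕ} (heven : Even (Nh dg)) (x : HE k dg)
    (t : ℕ) (z : Fin t → HE k dg) :
    ((Nh dg : ℝ)⁻¹) ^ t * ∑ y : Fin t → HE k dg,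
      (if FreshMatching x z y then ∏ i, nbrKernel dg (y i) (z i) else 0) ≤
      annealedProb dg x t z := by
  unfold annealedProb
  simp_rw [walkProb_eq_sum]
  rw [sum_comm, mul_sum, mul_sum]
  refine sum_le_sum fun y _ => ?_
  rw [← sum_filter, sum_const, nsmul_eq_mul]
  have hprod : 0 ≤ ∏ i, nbrKernel dg (y i) (z i) :=
    prod_nonneg fun i _ => nbrKernel_nonneg _ _ _
  split_ifs with h
  · rw [← mul_assoc]
    refine mul_le_mul_of_nonneg_right ?_ hprod
    have hP : (0 : ℝ) < (PairingsF dg).card := by exact_mod_cast pairingsF_card_pos heven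
    have hN : (0 : ℝ) < Nh dg := by
      rw [← card_halfEdges]
      exact_mod_cast Fintype.card_pos_iff.2 ⟨x⟩
    have hcount := card_pairings_le_pow_mul_card_prescribed (prevState x z) y h.1 h.2.1 h.2.2
    have hcount' : ((PairingsF dg).card : ℝ) ≤ (Nh dg : ℝ) ^ t *
        #{π ∈ PairingsF dg | ∀ i, π (prevState x z i) = y i} := by
      rw [card_halfEdges] at hcount
      rw [PairingsF, filter_filter]
      unfold IsPairing
      exact_mod_cast (by convert hcount)
    rw [inv_pow, inv_mul_eq_div, le_div_iff₀ hP, inv_mul_le_iff₀ (pow_pos hN t)]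
    exact hcount'
  · rw [mul_zero]
    positivity

/-- Joint law of a uniform half-edge and of a uniform neighbour of it. -/
def neighbourPairLaw {k : ℕ} (dg : Fin k → ℕ) (p : HE k dg × HE k dg) : ℝ :=
  (Nh dg : ℝ)⁻¹ * nbrKernel dg p.2 p.1

lemma neighbourPairLaw_nonneg {k : ℕ} (dg : Fin k → ℕ) (p : HE k dg × HE k dg) :
    0 ≤ neighbourPairLaw dg p :=
  mul_nonneg (by positivity) (nbrKernel_nonneg _ _ _)

lemma neighbourPairLaw_fst {k : ℕ} {dg : Fin k → ℕ} (hdg : ∀ v, 2 ≤ dg v) (a : HE k dg) :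
    ∑ p, neighbourPairLaw dg p * (if p.1 = a then 1 else 0) = (Nh dg : ℝ)⁻¹ := by
  rw [Fintype.sum_prod_type, Finset.sum_eq_single a]
  · simp only [neighbourPairLaw, nbrKernel_comm dg _ a, if_true, mul_one]
    rw [← mul_sum, sum_nbrKernel hdg, mul_one]
  · intro b _ hb
    simp [hb]
  · simp

lemma neighbourPairLaw_snd {k : ℕ} {dg : Fin k → ℕ} (hdg : ∀ v, 2 ≤ dg v) (a : HE k dg) :
    ∑ p, neighbourPairLaw dg p * (if p.2 = a then 1 else 0) = (Nh dg : ℝ)⁻¹ := by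
  rw [Fintype.sum_prod_type_right, Finset.sum_eq_single a]
  · simp only [neighbourPairLaw, if_true, mul_one]
    rw [← mul_sum, sum_nbrKernel hdg, mul_one]
  · intro b _ hb
    simp [hb]
  · simp

lemma sum_neighbourPairLaw {k : ℕ} {dg : Fin k → ℕ} (hdg : ∀ v, 2 ≤ dg v) (x : HE k dg) :
    ∑ p, neighbourPairLaw dg p = 1 := by
  have hN : (Nh dg : ℝ) ≠ 0 := by
    rw [← card_halfEdges]
    exact_mod_cast (Fintype.card_pos_iff.2 ⟨x⟩).ne'
  simp only [neighbourPairLaw]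
  rw [Fintype.sum_prod_type_right]
  simp only [← mul_sum, sum_nbrKernel hdg]
  rw [sum_const, card_univ, card_halfEdges, nsmul_eq_mul, mul_one, inv_mul_cancel₀ hN]

lemma prevState_collision {k : ℕ} {dg : Fin k → ℕ} (hdg : ∀ v, 2 ≤ dg v) (x : HE k dg) {t : ℕ}
    {i j : Fin t} (hij : i < j) :
    ∑ p : Fin t → HE k dg × HE k dg, (∏ l, neighbourPairLaw dg (p l)) *
      (if prevState x (fun l => (p l).1) i = prevState x (fun l => (p l).1) j then 1 else 0) ≤
      (Nh dg : ℝ)⁻¹ := by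
  have hm := sum_neighbourPairLaw hdg x
  have : Nonempty (HE k dg) := ⟨x⟩
  have hj : (j : ℕ) ≠ 0 := by have := Fin.lt_def.1 hij; omega
  unfold prevState
  simp only [hj, if_false]
  by_cases hi : (i : ℕ) = 0
  · simp only [hi, if_true, eq_comm (a := x)]
    refine le_of_eq ?_
    rw [sum_pi_prod_mul_one (neighbourPairLaw dg) (fun b => if b.1 = x then 1 else 0) hm]
    exact neighbourPairLaw_fst hdg x
  · simp only [hi, if_false]
    refine le_of_eq ?_
    rw [collision_probability (neighbourPairLaw dg) hm Prod.fst Prod.fst, card_halfEdges]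
    · rw [card_halfEdges]; exact neighbourPairLaw_fst hdg
    · rw [card_halfEdges]; exact neighbourPairLaw_fst hdg
    · have := Fin.lt_def.1 hij
      simp only [ne_eq, Fin.mk.injEq]
      omega

lemma matched_collision {k : ℕ} {dg : Fin k → ℕ} (hdg : ∀ v, 2 ≤ dg v) (x : HE k dg) {t : ℕ}
    {i j : Fin t} (hij : i ≠ j) :
    ∑ p : Fin t → HE k dg × HE k dg, (∏ l, neighbourPairLaw dg (p l)) *
      (if (p i).2 = (p j).2 then 1 else 0) ≤ (Nh dg : ℝ)⁻¹ := by
  have hm := sum_neighbourPairLaw hdg x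
  have : Nonempty (HE k dg) := ⟨x⟩
  refine le_of_eq ?_
  rw [collision_probability (neighbourPairLaw dg) hm Prod.snd Prod.snd _ _ hij, card_halfEdges]
  · rw [card_halfEdges]; exact neighbourPairLaw_snd hdg
  · rw [card_halfEdges]; exact neighbourPairLaw_snd hdg

lemma prevState_matched_collision {k : ℕ} {dg : Fin k → ℕ} (hdg : ∀ v, 2 ≤ dg v) (x : HE k dg) {t : ℕ}
    (i j : Fin t) :
    ∑ p : Fin t → HE k dg × HE k dg, (∏ l, neighbourPairLaw dg (p l)) *
      (if prevState x (fun l => (p l).1) i = (p j).2 then 1 else 0) ≤ (Nh dg : ℝ)⁻¹ := by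
  have hm := sum_neighbourPairLaw hdg x
  have : Nonempty (HE k dg) := ⟨x⟩
  unfold prevState
  by_cases hi : (i : ℕ) = 0
  · simp only [hi, if_true, eq_comm (a := x)]
    refine le_of_eq ?_
    rw [sum_pi_prod_mul_one (neighbourPairLaw dg) (fun b => if b.2 = x then 1 else 0) hm]
    exact neighbourPairLaw_snd hdg x
  · simp only [hi, if_false]
    generalize (⟨(i : ℕ) - 1, _⟩ : Fin t) = i'
    by_cases hij : i' = j
    · subst hij
      rw [sum_pi_prod_mul_one (neighbourPairLaw dg) (fun b => if b.1 = b.2 then 1 else 0) hm]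
      refine le_of_eq_of_le (sum_eq_zero fun b _ => ?_) (by positivity)
      split_ifs with h
      · simp [neighbourPairLaw, h, nbrKernel_self]
      · simp
    · refine le_of_eq ?_
      rw [collision_probability (neighbourPairLaw dg) hm Prod.fst Prod.snd _ _ hij,
        card_halfEdges]
      · rw [card_halfEdges]; exact neighbourPairLaw_fst hdg
      · rw [card_halfEdges]; exact neighbourPairLaw_snd hdg

/-- Indicator of the collision attributed to the ordered pair of times `(i, j)`. -/
def collisionIndicator {α : Type*} {t : ℕ} (x : α) (z y : Fin t → α) (i j : Fin t) : ℝ :=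
  (if i < j then (if prevState x z i = prevState x z j then 1 else 0)
    else if j < i then (if y i = y j then 1 else 0) else 0) +
    (if prevState x z i = y j then 1 else 0)

lemma collisionIndicator_nonneg {α : Type*} {t : ℕ} (x : α) (z y : Fin t → α) (i j : Fin t) :
    0 ≤ collisionIndicator x z y i j := by
  unfold collisionIndicator
  refine add_nonneg ?_ ?_ <;> split_ifs <;> norm_num

lemma injective_of_ne_of_lt {ι α : Type*} [LinearOrder ι] {f : ι → α}
    (h : ∀ i j, i < j → f i ≠ f j) : Function.Injective f := by
  intro i j he
  by_contra hne
  rcases lt_or_gt_of_ne hne with hlt | hlt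
  · exact h i j hlt he
  · exact h j i hlt he.symm

lemma exists_collision_of_not_freshMatching {α : Type*} {t : ℕ} (x : α) (z y : Fin t → α)
    (h : ¬ FreshMatching x z y) : ∃ i j, 1 ≤ collisionIndicator x z y i j := by
  have hi : ∀ (P : Prop), (0 : ℝ) ≤ if P then 1 else 0 := fun P => by split_ifs <;> norm_num
  by_contra! hc
  refine h ⟨?_, ?_, ?_⟩
  · refine injective_of_ne_of_lt fun i j hij he => (hc i j).not_ge ?_
    rw [collisionIndicator, if_pos hij, if_pos he]
    exact le_add_of_nonneg_right (hi _)
  · refine injective_of_ne_of_lt fun i j hij he => (hc j i).not_ge ?_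
    rw [collisionIndicator, if_neg hij.not_gt, if_pos hij, if_pos he.symm]
    exact le_add_of_nonneg_right (hi _)
  · intro i j he
    refine (hc i j).not_ge ?_
    rw [collisionIndicator, if_pos he]
    refine le_add_of_nonneg_left ?_
    split_ifs <;> norm_num

lemma one_sub_le_sum_collisionIndicator {α : Type*} {t : ℕ} (x : α) (z y : Fin t → α) :
    (1 : ℝ) - (if FreshMatching x z y then 1 else 0) ≤
      ∑ i, ∑ j, collisionIndicator x z y i j := by
  have hnn := collisionIndicator_nonneg x z y
  split_ifs with h
  · rw [sub_self]
    exact sum_nonneg fun i _ => sum_nonneg fun j _ => hnn i j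
  · obtain ⟨i, j, hij⟩ := exists_collision_of_not_freshMatching x z y h
    rw [sub_zero]
    exact hij.trans ((single_le_sum (fun j _ => hnn i j) (mem_univ j)).trans
      (single_le_sum (f := fun i => ∑ j, collisionIndicator x z y i j)
        (fun i _ => sum_nonneg fun j _ => hnn i j) (mem_univ i)))

/-- Expected number of collisions attributed to a given pair of times. -/
lemma sum_collisionIndicator_le {k : ℕ} {dg : Fin k → ℕ} (hdg : ∀ v, 2 ≤ dg v) (x : HE k dg)
    {t : ℕ} (i j : Fin t) :
    ∑ p : Fin t → HE k dg × HE k dg, (∏ l, neighbourPairLaw dg (p l)) *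
      collisionIndicator x (fun l => (p l).1) (fun l => (p l).2) i j ≤ 2 * (Nh dg : ℝ)⁻¹ := by
  simp only [collisionIndicator, mul_add, sum_add_distrib]
  rw [two_mul]
  refine add_le_add ?_ ?_
  · rcases lt_trichotomy i j with h | h | h
    · simp only [h, if_true]
      convert! prevState_collision hdg x h
    · simp [h]
    · simp only [h, h.not_gt, if_true, if_false]
      convert! matched_collision hdg x h.ne'
  · convert! prevState_matched_collision hdg x i j

/-- The total annealed deficit with respect to the uniform law. -/
lemma sum_deficit_le {k : ℕ} {dg : Fin k → ℕ} (hdg : ∀ v, 2 ≤ dg v) (heven : Even (Nh dg))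
    (x : HE k dg) (t : ℕ) :
    ∑ z : Fin t → HE k dg, max (((Nh dg : ℝ)⁻¹) ^ t - annealedProb dg x t z) 0 ≤
      2 * t ^ 2 / (Nh dg : ℝ) := by
  have hpoint : ∀ z : Fin t → HE k dg,
      max (((Nh dg : ℝ)⁻¹) ^ t - annealedProb dg x t z) 0 ≤
      ∑ y : Fin t → HE k dg, (∏ l, neighbourPairLaw dg (z l, y l)) *
        ∑ i, ∑ j, collisionIndicator x z y i j := by
    intro z
    refine max_le ?_ ?_
    · have hone : ∑ y : Fin t → HE k dg, ∏ i, nbrKernel dg (y i) (z i) = 1 := by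
        rw [← Fintype.prod_sum (fun i y => nbrKernel dg y (z i))]
        simp only [nbrKernel_comm dg _ (z _), sum_nbrKernel hdg, prod_const_one]
      calc ((Nh dg : ℝ)⁻¹) ^ t - annealedProb dg x t z
          ≤ ((Nh dg : ℝ)⁻¹) ^ t * ∑ y : Fin t → HE k dg, ∏ i, nbrKernel dg (y i) (z i) -
            ((Nh dg : ℝ)⁻¹) ^ t * ∑ y : Fin t → HE k dg,
              (if FreshMatching x z y then ∏ i, nbrKernel dg (y i) (z i) else 0) := by
            rw [hone, mul_one]
            exact sub_le_sub_left (le_annealedProb heven x t z) _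
        _ = ∑ y : Fin t → HE k dg, (∏ l, neighbourPairLaw dg (z l, y l)) *
              (1 - if FreshMatching x z y then 1 else 0) := by
            rw [← mul_sub, ← sum_sub_distrib, mul_sum]
            refine sum_congr rfl fun y _ => ?_
            simp only [neighbourPairLaw, prod_mul_distrib, prod_const, card_univ,
              Fintype.card_fin]
            split_ifs <;> ring
        _ ≤ _ := sum_le_sum fun y _ => mul_le_mul_of_nonneg_left
            (one_sub_le_sum_collisionIndicator x z y)
            (prod_nonneg fun _ _ => neighbourPairLaw_nonneg _ _)
    · exact sum_nonneg fun y _ => mul_nonneg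
        (prod_nonneg fun _ _ => neighbourPairLaw_nonneg _ _)
        (sum_nonneg fun i _ => sum_nonneg fun j _ => collisionIndicator_nonneg x z y i j)
  calc _ ≤ ∑ z : Fin t → HE k dg, ∑ y : Fin t → HE k dg,
        (∏ l, neighbourPairLaw dg (z l, y l)) * ∑ i, ∑ j, collisionIndicator x z y i j :=
        sum_le_sum fun z _ => hpoint z
    _ = ∑ p : Fin t → HE k dg × HE k dg, (∏ l, neighbourPairLaw dg (p l)) *
        ∑ i, ∑ j, collisionIndicator x (fun l => (p l).1) (fun l => (p l).2) i j := by
        rw [← Fintype.sum_prod_type',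
          ← (Equiv.arrowProdEquivProdArrow (Fin t) (fun _ => HE k dg) (fun _ => HE k dg)).sum_comp]
        rfl
    _ = ∑ i, ∑ j, ∑ p : Fin t → HE k dg × HE k dg, (∏ l, neighbourPairLaw dg (p l)) *
        collisionIndicator x (fun l => (p l).1) (fun l => (p l).2) i j := by
        simp only [mul_sum]
        rw [sum_comm]
        exact sum_congr rfl fun i _ => sum_comm
    _ ≤ ∑ _i : Fin t, ∑ _j : Fin t, 2 * (Nh dg : ℝ)⁻¹ :=
        sum_le_sum fun i _ => sum_le_sum fun j _ => sum_collisionIndicator_le hdg x i j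
    _ = _ := by
        simp only [sum_const, card_univ, Fintype.card_fin, nsmul_eq_mul]
        ring

/-- If `p` has at most the total mass of `q`, both half the `ℓ¹` distance and the difference on
any event are bounded by the total deficit of `p` with respect to `q`. -/
lemma half_sum_abs_sub_le {ι : Type*} [Fintype ι] (p q : ι → ℝ) {c : ℝ}
    (hpq : ∑ z, p z ≤ ∑ z, q z) (hc : ∑ z, max (q z - p z) 0 ≤ c) :
    (1 : ℝ) / 2 * ∑ z, |p z - q z| ≤ c := by
  have h : ∀ z, |p z - q z| = 2 * max (q z - p z) 0 + (p z - q z) := by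
    intro z
    rcases le_total (p z) (q z) with h | h
    · rw [abs_of_nonpos (by linarith), max_eq_left (by linarith)]; ring
    · rw [abs_of_nonneg (by linarith), max_eq_right (by linarith)]; ring
  simp_rw [h]
  rw [sum_add_distrib, sum_sub_distrib, ← mul_sum]
  linarith

lemma abs_sum_ite_sub_le {ι : Type*} [Fintype ι] (p q : ι → ℝ) {c : ℝ}
    (hpq : ∑ z, p z ≤ ∑ z, q z) (hc : ∑ z, max (q z - p z) 0 ≤ c) (A : ι → Prop)
    [DecidablePred A] :
    |(∑ z, if A z then p z else 0) - ∑ z, if A z then q z else 0| ≤ c := by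
  have h1 : (∑ z, if A z then q z else 0) - (∑ z, if A z then p z else 0) ≤
      ∑ z, max (q z - p z) 0 := by
    rw [← sum_sub_distrib]
    refine sum_le_sum fun z _ => ?_
    split_ifs
    · exact le_max_left _ _
    · simp
  have h2 : (∑ z, if A z then p z else 0) - (∑ z, if A z then q z else 0) ≤
      ∑ z, (max (q z - p z) 0 + (p z - q z)) := by
    rw [← sum_sub_distrib]
    refine sum_le_sum fun z _ => ?_
    split_ifs
    · linarith [le_max_right (q z - p z) 0]
    · linarith [le_max_left (q z - p z) 0]
  rw [sum_add_distrib, sum_sub_distrib] at h2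
  exact abs_le.2 ⟨by linarith, by linarith⟩

/-- **Coupling of the annealed NBRW with uniform samples**: the annealed law of
`(X_1, …, X_t)` and the law of `t` i.i.d. uniform half-edges are within
total-variation distance `2t²/N`; in particular the probabilities that the walk
weight exceeds any threshold `θ` differ by at most `2t²/N`. -/
theorem annealed_coupling {k : ℕ} (hk : 0 < k) (dg : Fin k → ℕ)
    (hdg : ∀ v, 2 ≤ dg v) (heven : Even (Nh dg)) (x : HE k dg) (t : ℕ) :
    ((1 : ℝ) / 2) * (∑ z : Fin t → HE k dg,
        |annealedProb dg x t z - ((Nh dg : ℝ)⁻¹) ^ t|) ≤ 2 * t ^ 2 / (Nh dg : ℝ) ∧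
    ∀ θ : ℝ, 0 < θ →
      |(∑ z : Fin t → HE k dg,
          if θ < trajWeight dg z then annealedProb dg x t z else 0) -
        ∑ z : Fin t → HE k dg,
          if θ < trajWeight dg z then ((Nh dg : ℝ)⁻¹) ^ t else 0|
        ≤ 2 * t ^ 2 / (Nh dg : ℝ) := by
  have hN : (Nh dg : ℝ) ≠ 0 := by
    rw [← card_halfEdges]
    exact_mod_cast (Fintype.card_pos_iff.2 ⟨x⟩).ne'
  have hq : ∑ _z : Fin t → HE k dg, ((Nh dg : ℝ)⁻¹) ^ t = 1 := by
    rw [sum_const, card_univ, Fintype.card_fun, Fintype.card_fin, card_halfEdges, nsmul_eq_mul,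
      Nat.cast_pow, ← mul_pow, mul_inv_cancel₀ hN, one_pow]
  have hpq := (sum_annealedProb_le_one hdg t x).trans_eq hq.symm
  have hc := sum_deficit_le hdg heven x t
  exact ⟨half_sum_abs_sub_le _ _ hpq hc, fun θ _ => abs_sum_ite_sub_le _ _ hpq hc _⟩

end
end

section
/- Stein-pair variance bound for the random switch: in the setting of the random switch on a uniform pairing, with Y := Σ_{i∈I} w_{i,π(i)} − m where m := (1/(|I|−1)) Σ_{i∈I} Σ_{j≠i} w_{i,j}, θ := max_{i≠j} (w_{i,j} + w_{j,i}), and Y′ the corresponding quantity for the switched pairing π′, one has E[(Y′ − Y)² | π] ≤ (8θ/|I|)·(2m + Y) almost surely. -/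
open Classical Finset

noncomputable section

/-- The finite set of all pairings (fixed-point-free involutions) of `ι`. -/
def PairingsI (ι : Type) [Fintype ι] [DecidableEq ι] : Finset (Equiv.Perm ι) :=
  univ.filter fun π => (∀ x, π (π x) = x) ∧ ∀ x, π x ≠ x

/-- The random switch: the pairing obtained from `π` by replacing the pairs
`{i, π i}` and `{j, π j}` with `{i, j}` and `{π i, π j}`. (For a fixed-point-free
involution `π` and `i ≠ j` this permutation sends `i ↦ j`, `j ↦ i`,
`π i ↦ π j`, `π j ↦ π i`, and agrees with `π` elsewhere.) -/
def switchPerm {ι : Type} [DecidableEq ι] (π : Equiv.Perm ι) (i j : ι) :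
    Equiv.Perm ι :=
  π * (Equiv.swap i (π j) * Equiv.swap j (π i))

/-- Effect of the switch on the weight of a pairing, when `i` and `j` are not paired. -/
theorem sum_switchPerm_sub {ι : Type} [Fintype ι] [DecidableEq ι] (w : ι → ι → ℝ)
    (π : Equiv.Perm ι) (hπ1 : ∀ x, π (π x) = x) (hπ2 : ∀ x, π x ≠ x) {i j : ι}
    (hij : i ≠ j) (hj : j ≠ π i) :
    (∑ k, w k (switchPerm π i j k)) - ∑ k, w k (π k) =
      w i j + w j i + w (π i) (π j) + w (π j) (π i)
        - w i (π i) - w (π i) i - w j (π j) - w (π j) j := by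
  have hi : i ≠ π j := fun h => hj (by rw [h, hπ1])
  have hpp : π i ≠ π j := fun h => hij (π.injective h)
  have h1 : i ≠ π i := (hπ2 i).symm
  have h2 : j ≠ π j := (hπ2 j).symm
  have ei : switchPerm π i j i = j := by
    simp [switchPerm, Equiv.swap_apply_of_ne_of_ne hij h1, hπ1]
  have ej : switchPerm π i j j = i := by
    simp [switchPerm, Equiv.swap_apply_of_ne_of_ne h1.symm hpp, hπ1]
  have epi : switchPerm π i j (π i) = π j := by
    simp [switchPerm, Equiv.swap_apply_of_ne_of_ne hij.symm h2]
  have epj : switchPerm π i j (π j) = π i := by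
    simp [switchPerm, Equiv.swap_apply_of_ne_of_ne h2.symm hpp.symm]
  rw [← Finset.sum_sub_distrib,
    ← Finset.sum_subset (Finset.subset_univ ({i, j, π i, π j} : Finset ι))]
  · rw [Finset.sum_insert (by simp [hij, h1, hi]), Finset.sum_insert (by simp [hj, h2]),
      Finset.sum_insert (by simp [hij]), Finset.sum_singleton, ei, ej, epi, epj, hπ1, hπ1]
    ring
  · intro k _ hk
    simp only [Finset.mem_insert, Finset.mem_singleton, not_or] at hk
    obtain ⟨k1, k2, k3, k4⟩ := hk
    simp [switchPerm, Equiv.swap_apply_of_ne_of_ne k2 k3, Equiv.swap_apply_of_ne_of_ne k1 k4]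

/-- Switching two paired indices does nothing. -/
theorem switchPerm_self_pair {ι : Type} [DecidableEq ι] (π : Equiv.Perm ι)
    (hπ1 : ∀ x, π (π x) = x) (i : ι) : switchPerm π i (π i) = π := by
  simp [switchPerm, hπ1, Equiv.Perm.one_def.symm]

theorem sq_sum_switchPerm_sub_le {ι : Type} [Fintype ι] [DecidableEq ι] (w : ι → ι → ℝ)
    (hw : ∀ i j, 0 ≤ w i j) {θ : ℝ} (hθ : ∀ i j, i ≠ j → w i j + w j i ≤ θ)
    (π : Equiv.Perm ι) (hπ1 : ∀ x, π (π x) = x) (hπ2 : ∀ x, π x ≠ x) {i j : ι}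
    (hij : i ≠ j) :
    ((∑ k, w k (switchPerm π i j k)) - ∑ k, w k (π k)) ^ 2 ≤
      2 * θ * ((w i j + w j i) + (w (π i) (π j) + w (π j) (π i))
        + (w i (π i) + w (π i) i) + (w j (π j) + w (π j) j)) := by
  have a1 := hθ i j hij
  have a2 := hθ (π i) (π j) fun h => hij (π.injective h)
  have a3 := hθ i (π i) (hπ2 i).symm
  have a4 := hθ j (π j) (hπ2 j).symm
  have b1 := add_nonneg (hw i j) (hw j i)
  have b2 := add_nonneg (hw (π i) (π j)) (hw (π j) (π i))
  have b3 := add_nonneg (hw i (π i)) (hw (π i) i)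
  have b4 := add_nonneg (hw j (π j)) (hw (π j) j)
  by_cases hj : j = π i
  · rw [hj, switchPerm_self_pair π hπ1 i, ← hj, sub_self, zero_pow two_ne_zero]
    exact mul_nonneg (by linarith) (by linarith)
  · rw [sum_switchPerm_sub w π hπ1 hπ2 hij hj, ← sq_abs, sq]
    exact mul_le_mul (abs_le.2 ⟨by linarith, by linarith⟩)
      (abs_le.2 ⟨by linarith, by linarith⟩) (abs_nonneg _) (by linarith)

theorem sum_offDiag_eq_sum_erase {ι : Type} [Fintype ι] [DecidableEq ι] (f : ι → ι → ℝ) :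
    ∑ p ∈ (univ.offDiag : Finset (ι × ι)), f p.1 p.2 = ∑ i, ∑ j ∈ univ.erase i, f i j :=
  Finset.sum_finset_product' _ _ _ (by simp [Finset.mem_offDiag, eq_comm])

theorem sum_offDiag_swap {ι : Type} [Fintype ι] [DecidableEq ι] (f : ι → ι → ℝ) :
    ∑ p ∈ (univ.offDiag : Finset (ι × ι)), f p.2 p.1 =
      ∑ p ∈ (univ.offDiag : Finset (ι × ι)), f p.1 p.2 :=
  Finset.sum_equiv (Equiv.prodComm ι ι) (by simp [Finset.mem_offDiag, eq_comm]) (by simp)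

theorem sum_offDiag_perm {ι : Type} [Fintype ι] [DecidableEq ι] (π : Equiv.Perm ι)
    (f : ι → ι → ℝ) :
    ∑ p ∈ (univ.offDiag : Finset (ι × ι)), f (π p.1) (π p.2) =
      ∑ p ∈ (univ.offDiag : Finset (ι × ι)), f p.1 p.2 :=
  Finset.sum_equiv (Equiv.prodCongr π π) (by simp [Finset.mem_offDiag]) (by simp)

theorem sum_offDiag_fst {ι : Type} [Fintype ι] [DecidableEq ι] (g : ι → ℝ) :
    ∑ p ∈ (univ.offDiag : Finset (ι × ι)), g p.1 = ((Fintype.card ι : ℝ) - 1) * ∑ i, g i := by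
  rw [sum_offDiag_eq_sum_erase fun i _ => g i, Finset.mul_sum]
  refine Finset.sum_congr rfl fun i _ => ?_
  rw [Finset.sum_const, nsmul_eq_mul, Finset.cast_card_erase_of_mem (Finset.mem_univ i),
    Finset.card_univ]

/-- **Stein-pair variance bound for the random switch**: with
`Y = Σ_i w_{i,π(i)} - m`, `m = (|I|-1)⁻¹ Σ_i Σ_{j≠i} w_{i,j}`,
`θ ≥ max_{i≠j}(w_{i,j} + w_{j,i})`, and `Y′` the corresponding quantity for the
switched pairing, one has `E[(Y′ - Y)² | π] ≤ (8θ/|I|)(2m + Y)` (the conditional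
expectation being the average over the uniform ordered pair of switch indices). -/
theorem stein_pair_variance_bound (ι : Type) [Fintype ι] [DecidableEq ι]
    (heven : Even (Fintype.card ι)) (hcard : 2 ≤ Fintype.card ι)
    (w : ι → ι → ℝ) (hw : ∀ i j, 0 ≤ w i j) (m θ : ℝ)
    (hm : m = ((Fintype.card ι : ℝ) - 1)⁻¹ * ∑ i, ∑ j ∈ univ.erase i, w i j)
    (hθ : ∀ i j, i ≠ j → w i j + w j i ≤ θ)
    (π : Equiv.Perm ι) (hπ1 : ∀ x, π (π x) = x) (hπ2 : ∀ x, π x ≠ x) :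
    ((Fintype.card ι : ℝ) * ((Fintype.card ι : ℝ) - 1))⁻¹ *
        ∑ p ∈ (univ.offDiag : Finset (ι × ι)),
          ((∑ i, w i (switchPerm π p.1 p.2 i)) - ∑ i, w i (π i)) ^ 2
      ≤ (8 * θ / (Fintype.card ι : ℝ)) * (2 * m + ((∑ i, w i (π i)) - m)) := by
  have hn : (2 : ℝ) ≤ (Fintype.card ι : ℝ) := by exact_mod_cast hcard
  have hn1 : (0 : ℝ) < (Fintype.card ι : ℝ) - 1 := by linarith
  have hsum : ∑ i, ∑ j ∈ univ.erase i, w i j = ((Fintype.card ι : ℝ) - 1) * m := by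
    rw [hm, mul_inv_cancel_left₀ hn1.ne']
  have hinv : ∑ i, w (π i) i = ∑ i, w i (π i) := by
    rw [← Equiv.sum_comp π fun i => w i (π i)]
    simp only [hπ1]
  have hbound := Finset.sum_le_sum fun p (hp : p ∈ (univ.offDiag : Finset (ι × ι))) =>
    sq_sum_switchPerm_sub_le w hw hθ π hπ1 hπ2 (Finset.mem_offDiag.1 hp).2.2
  rw [← Finset.mul_sum] at hbound
  simp only [Finset.sum_add_distrib] at hbound
  rw [sum_offDiag_swap fun i j => w (π i) (π j), sum_offDiag_perm π w, sum_offDiag_swap w,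
    sum_offDiag_swap fun i _ => w i (π i), sum_offDiag_swap fun i _ => w (π i) i,
    sum_offDiag_fst fun i => w i (π i), sum_offDiag_fst fun i => w (π i) i, hinv,
    sum_offDiag_eq_sum_erase w, hsum] at hbound
  refine (mul_le_mul_of_nonneg_left hbound (by positivity)).trans (le_of_eq ?_)
  have hn0 : (Fintype.card ι : ℝ) ≠ 0 := by positivity
  field_simp
  ring

end
end
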